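/- Let H''_{n,r} be the associative unital R-algebra with generators g'_1,…,g'_{n−1} and b'_{k_1,…,k_n} for (k_1,…,k_n) ∈ [1,r]^n, and defining relations: (1) g'_i g'_j = g'_j g'_i for |i − j| > 1; (2) g'_i g'_{i+1} g'_i = g'_{i+1} g'_i g'_{i+1}; (3) (g'_i)² = 1 + (q − q^{−1})·e'_i·g'_i, where e'_i := Σ_{(k_1,…,k_n) with k_i = k_{i+1}} b'_{k_1,…,k_n}; (4) b'_{k_1,…,k_n}·b'_{k'_1,…,k'_n} = δ_{(k_1,…,k_n),(k'_1,…,k'_n)}·b'_{k_1,…,k_n}; (5) g'_i·b'_{k_1,…,k_n} = b'_{s_i·(k_1,…,k_n)}·g'_i, where s_i·(k_1,…,k_n) swaps the i-th and (i+1)-st entries; (6) Σ_{(k_1,…,k_n) ∈ [1,r]^n} b'_{k_1,…,k_n} = 1. Then the R-algebra homomorphism H''_{n,r} → H_{n,r} sending g'_i ↦ g_i and b'_{k_1,…,k_n} ↦ b_{k_1,…,k_n} is an isomorphism. In particular, H_{n,r} admits a presentation in which the parameters u_1,…,u_r do not appear. -/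

import Mathlib

open Polynomial

namespace MAK

noncomputable section

variable (R : Type*) [CommRing R] (n r : ℕ) (q Δ : Rˣ) (u : Fin r → R) (F : Fin r → R[X])

/-- The free `R`-algebra on generators `t_1, …, t_n` (left) and `T_1, …, T_{n-1}` (right). -/
abbrev FA := FreeAlgebra R (Fin n ⊕ Fin (n - 1))

/-- The generators `t_i`. -/
def tf (i : Fin n) : FA R n := FreeAlgebra.ι R (Sum.inl i)

/-- The generators `T_j`. -/
def Tf (j : Fin (n - 1)) : FA R n := FreeAlgebra.ι R (Sum.inr j)

/-- The index `j`, viewed in `Fin n`. -/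
def lo (j : Fin (n - 1)) : Fin n := ⟨j.1, by have := j.2; omega⟩

/-- The index `j + 1`, viewed in `Fin n`. -/
def hi (j : Fin (n - 1)) : Fin n := ⟨j.1 + 1, by have := j.2; omega⟩

/-- The element `B_j = Δ⁻² Σ_{c1<c2} (u_{c2} - u_{c1})(q - q⁻¹) F_{c1}(t_j) F_{c2}(t_{j+1})`. -/
def Bel (j : Fin (n - 1)) : FA R n :=
  ∑ c2 : Fin r, ∑ c1 ∈ Finset.univ.filter (fun c1 => c1 < c2),
    (((Δ⁻¹ : Rˣ) : R) ^ 2 * ((u c2 - u c1) * ((q : R) - ((q⁻¹ : Rˣ) : R)))) •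
      (aeval (tf R n (lo n j)) (F c1) * aeval (tf R n (hi n j)) (F c2))

/-- The defining relations of the modified Ariki-Koike algebra. -/
inductive Rel : FA R n → FA R n → Prop
  | quad (j : Fin (n - 1)) :
      Rel ((Tf R n j - algebraMap R (FA R n) (q : R)) *
        (Tf R n j + algebraMap R (FA R n) ((q⁻¹ : Rˣ) : R))) 0
  | tord (i : Fin n) : Rel (aeval (tf R n i) (∏ c : Fin r, (X - C (u c)))) 0
  | braid (j k : Fin (n - 1)) (h : k.1 = j.1 + 1) :
      Rel (Tf R n j * Tf R n k * Tf R n j) (Tf R n k * Tf R n j * Tf R n k)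
  | Tcomm (j k : Fin (n - 1)) (h : j.1 + 2 ≤ k.1 ∨ k.1 + 2 ≤ j.1) :
      Rel (Tf R n j * Tf R n k) (Tf R n k * Tf R n j)
  | tcomm (i i' : Fin n) : Rel (tf R n i * tf R n i') (tf R n i' * tf R n i)
  | Tt (j : Fin (n - 1)) (i : Fin n) (h1 : i ≠ lo n j) (h2 : i ≠ hi n j) :
      Rel (Tf R n j * tf R n i) (tf R n i * Tf R n j)
  | Thi (j : Fin (n - 1)) :
      Rel (Tf R n j * tf R n (hi n j)) (tf R n (lo n j) * Tf R n j + Bel R n r q Δ u F j)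
  | Tlo (j : Fin (n - 1)) :
      Rel (Tf R n j * tf R n (lo n j)) (tf R n (hi n j) * Tf R n j - Bel R n r q Δ u F j)

/-- The modified Ariki-Koike algebra `H_{n,r}(R, q, u_1, …, u_r)`. -/
abbrev Hnr := RingQuot (Rel R n r q Δ u F)

/-- The canonical projection. -/
def pim : FA R n →ₐ[R] Hnr R n r q Δ u F := RingQuot.mkAlgHom R (Rel R n r q Δ u F)

/-- The generator `t_i` of `H_{n,r}`. -/
def tt (i : Fin n) : Hnr R n r q Δ u F := pim R n r q Δ u F (tf R n i)

/-- The generator `T_j` of `H_{n,r}`. -/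
def TT (j : Fin (n - 1)) : Hnr R n r q Δ u F := pim R n r q Δ u F (Tf R n j)

/-- The Lagrange basis polynomial `∏_{j ≠ c} (X - u_j)/(u_c - u_j)`. -/
def bpoly (c : Fin r) : R[X] :=
  ∏ j ∈ Finset.univ.filter (fun j => j ≠ c), Ring.inverse (u c - u j) • (X - C (u j))

/-- The idempotent `b_{k_1, …, k_n}`. -/
def b (k : Fin n → Fin r) : Hnr R n r q Δ u F :=
  (List.ofFn fun i : Fin n => aeval (tt R n r q Δ u F i) (bpoly R r u (k i))).prod

/-- The element `B'_{i,j} = -(q - q⁻¹) Σ_{k_i < k_j} b_{k_1, …, k_n}`. -/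
def B' (i j : Fin n) : Hnr R n r q Δ u F :=
  -(((q : R) - ((q⁻¹ : Rˣ) : R)) •
    ∑ k ∈ Finset.univ.filter (fun k : Fin n → Fin r => k i < k j), b R n r q Δ u F k)

/-- The element `g_i := T_i + B'_{i,i+1}`. -/
def g (j : Fin (n - 1)) : Hnr R n r q Δ u F :=
  TT R n r q Δ u F j + B' R n r q Δ u F (lo n j) (hi n j)

/-- The idempotent `e_{i,j} = Σ_{k_i = k_j} b_{k_1, …, k_n}`. -/
def eij (i j : Fin n) : Hnr R n r q Δ u F :=
  ∑ k ∈ Finset.univ.filter (fun k : Fin n → Fin r => k i = k j), b R n r q Δ u F k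

/-- The idempotent `e_i = e_{i,i+1}`. -/
def ee (j : Fin (n - 1)) : Hnr R n r q Δ u F := eij R n r q Δ u F (lo n j) (hi n j)

/-- The simple transposition `s_j = (j, j+1)` in `S_n`. -/
def simple (j : Fin (n - 1)) : Equiv.Perm (Fin n) := Equiv.swap (lo n j) (hi n j)

/-- `l` is a reduced word for the permutation `w`. -/
def IsReducedWord (w : Equiv.Perm (Fin n)) (l : List (Fin (n - 1))) : Prop :=
  (l.map (simple n)).prod = w ∧
    ∀ l' : List (Fin (n - 1)), (l'.map (simple n)).prod = w → l.length ≤ l'.length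

/-- The element `g_w = g_{i_1} ⋯ g_{i_l}` associated to a word `l = (i_1, …, i_l)`. -/
def gword (l : List (Fin (n - 1))) : Hnr R n r q Δ u F := (l.map (g R n r q Δ u F)).prod

/-- The element `T_w = T_{i_1} ⋯ T_{i_l}` associated to a word `l = (i_1, …, i_l)`. -/
def Tword (l : List (Fin (n - 1))) : Hnr R n r q Δ u F := (l.map (TT R n r q Δ u F)).prod

/-- The monomial `t_1^{c_1} ⋯ t_n^{c_n}`. -/
def tmon (c : Fin n → ℕ) : Hnr R n r q Δ u F :=
  (List.ofFn fun i : Fin n => tt R n r q Δ u F i ^ c i).prod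

end

end MAK

open MAK


namespace MAK

noncomputable section

variable (R : Type*) [CommRing R] (n r : ℕ) (q : Rˣ)

/-- The free algebra on generators `g'_j` and `b'_{k_1,…,k_n}`. -/
abbrev FA2 := FreeAlgebra R (Fin (n - 1) ⊕ (Fin n → Fin r))

/-- The generator `g'_j`. -/
def gf2 (j : Fin (n - 1)) : FA2 R n r := FreeAlgebra.ι R (Sum.inl j)

/-- The generator `b'_{k_1,…,k_n}`. -/
def bf2 (k : Fin n → Fin r) : FA2 R n r := FreeAlgebra.ι R (Sum.inr k)

/-- The element `e'_i = ∑_{k_i = k_{i+1}} b'_{k_1,…,k_n}`. -/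
def ef2 (j : Fin (n - 1)) : FA2 R n r :=
  ∑ k ∈ Finset.univ.filter (fun k : Fin n → Fin r => k (lo n j) = k (hi n j)), bf2 R n r k

/-- The relations (1)-(6) of Theorem 3.13, in which the parameters `u_1,…,u_r`
do not appear. -/
inductive Rel2 : FA2 R n r → FA2 R n r → Prop
  | gcomm (j k : Fin (n - 1)) (h : j.1 + 2 ≤ k.1 ∨ k.1 + 2 ≤ j.1) :
      Rel2 (gf2 R n r j * gf2 R n r k) (gf2 R n r k * gf2 R n r j)
  | gbraid (j k : Fin (n - 1)) (h : k.1 = j.1 + 1) :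
      Rel2 (gf2 R n r j * gf2 R n r k * gf2 R n r j)
        (gf2 R n r k * gf2 R n r j * gf2 R n r k)
  | gquad (j : Fin (n - 1)) :
      Rel2 (gf2 R n r j * gf2 R n r j)
        (1 + ((q : R) - ((q⁻¹ : Rˣ) : R)) • (ef2 R n r j * gf2 R n r j))
  | borth (k k' : Fin n → Fin r) :
      Rel2 (bf2 R n r k * bf2 R n r k') (if k = k' then bf2 R n r k else 0)
  | gb (j : Fin (n - 1)) (k : Fin n → Fin r) :
      Rel2 (gf2 R n r j * bf2 R n r k)
        (bf2 R n r (fun i => k (Equiv.swap (lo n j) (hi n j) i)) * gf2 R n r j)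
  | bsum : Rel2 (∑ k : Fin n → Fin r, bf2 R n r k) 1

/-- The algebra `H''_{n,r}` defined by the parameter-free presentation. -/
abbrev Hnr2 := RingQuot (Rel2 R n r q)

/-- The generator `g'_j` of `H''_{n,r}`. -/
def gg2 (j : Fin (n - 1)) : Hnr2 R n r q :=
  RingQuot.mkAlgHom R (Rel2 R n r q) (gf2 R n r j)

/-- The generator `b'_{k_1,…,k_n}` of `H''_{n,r}`. -/
def bb2 (k : Fin n → Fin r) : Hnr2 R n r q :=
  RingQuot.mkAlgHom R (Rel2 R n r q) (bf2 R n r k)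

end

end MAK

namespace MAK

noncomputable section

variable {R : Type*} [CommRing R] {n r : ℕ}

/-- The function `k ↦ u_{k_i}` on multi-indices. -/
def coordFun (u : Fin r → R) (i : Fin n) : (Fin n → Fin r) → R := fun k => u (k i)

/-- The function with value `a` where `k_i < k_j`, and `0` elsewhere. -/
def ltFun (a : R) (i j : Fin n) : (Fin n → Fin r) → R := fun k => if k i < k j then a else 0

/-- The function with value `a` where `k_i = k_j`, and `0` elsewhere. -/
def eqFun (a : R) (i j : Fin n) : (Fin n → Fin r) → R := fun k => if k i = k j then a else 0

/-- The action of the `j`-th simple transposition on functions of multi-indices. -/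
def swapFun (j : Fin (n - 1)) (f : (Fin n → Fin r) → R) : (Fin n → Fin r) → R :=
  fun k => f fun i => k (Equiv.swap (lo n j) (hi n j) i)

lemma lo_ne_hi (j : Fin (n - 1)) : lo n j ≠ hi n j := by
  simp [lo, hi]

lemma swapFun_coordFun (u : Fin r → R) (j : Fin (n - 1)) (i : Fin n) :
    swapFun j (coordFun u i) = coordFun u (Equiv.swap (lo n j) (hi n j) i) := rfl

lemma swapFun_ltFun (a : R) (l : Fin (n - 1)) (i j : Fin n) :
    swapFun (r := r) l (ltFun a i j) =
      ltFun a (Equiv.swap (lo n l) (hi n l) i) (Equiv.swap (lo n l) (hi n l) j) := rfl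

lemma eq_sum_smul_single {K : Type*} [Fintype K] [DecidableEq K] (f : K → R) :
    f = ∑ k, f k • (Pi.single k 1 : K → R) := by
  funext k
  simp [Finset.sum_apply, Pi.single_apply]

lemma bpoly_eval {u : Fin r → R} (hu : Pairwise fun c c' => IsUnit (u c - u c')) (c c' : Fin r) :
    (bpoly R r u c).eval (u c') = if c' = c then 1 else 0 := by
  rw [bpoly, eval_prod]
  split_ifs with h
  · subst h
    refine Finset.prod_eq_one fun j hj => ?_
    have hj' : j ≠ c' := by simpa using hj
    simp [Ring.inverse_mul_cancel _ (hu hj'.symm)]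
  · exact Finset.prod_eq_zero (i := c') (by simpa using h) (by simp)

lemma aeval_eq_of_eval_eq {A : Type*} [Ring A] [Algebra R A] {u : Fin r → R}
    (hu : Pairwise fun c c' => IsUnit (u c - u c')) {t : A}
    (ht : aeval t (∏ c : Fin r, (X - C (u c))) = 0) {f g : R[X]}
    (h : ∀ c, f.eval (u c) = g.eval (u c)) : aeval t f = aeval t g := by
  have hd : (∏ c : Fin r, (X - C (u c))) ∣ f - g := by
    refine Finset.prod_dvd_of_coprime (fun c _ c' _ hc => isCoprime_X_sub_C_of_isUnit_sub (hu hc))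
      fun c _ => ?_
    rw [dvd_iff_isRoot]
    simp [h c]
  obtain ⟨w, hw⟩ := hd
  rw [← sub_eq_zero, ← map_sub, hw, map_mul, ht, zero_mul]

/-- The algebra map determined by a complete system of orthogonal idempotents. -/
def idemHom {K A : Type*} [Fintype K] [DecidableEq K] [Ring A] [Algebra R A] (e : K → A)
    (ho : ∀ k k', e k * e k' = if k = k' then e k else 0) (hs : ∑ k, e k = 1) :
    (K → R) →ₐ[R] A :=
  AlgHom.ofLinearMap (Fintype.linearCombination R e)
    (by simp [Fintype.linearCombination_apply, hs])
    (fun f g => by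
      simp only [Fintype.linearCombination_apply, Finset.sum_mul_sum, ho, smul_mul_smul_comm,
        Pi.mul_apply]
      simp)

lemma idemHom_apply {K A : Type*} [Fintype K] [DecidableEq K] [Ring A] [Algebra R A] (e : K → A)
    (ho : ∀ k k', e k * e k' = if k = k' then e k else 0) (hs : ∑ k, e k = 1) (f : K → R) :
    idemHom e ho hs f = ∑ k, f k • e k := rfl

lemma exists_algHom_coordFun_comm {S : Type*} [CommRing S] [Algebra R S] {u : Fin r → R}
    (hu : Pairwise fun c c' => IsUnit (u c - u c')) (t : Fin n → S)
    (ht : ∀ i, aeval (t i) (∏ c : Fin r, (X - C (u c))) = 0) :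
    ∃ D : ((Fin n → Fin r) → R) →ₐ[R] S, ∀ i, D (coordFun u i) = t i := by
  have ho (i : Fin n) (c c' : Fin r) : aeval (t i) (bpoly R r u c) * aeval (t i) (bpoly R r u c') =
      if c = c' then aeval (t i) (bpoly R r u c) else 0 := by
    rw [← map_mul]
    have h0 : (0 : S) = aeval (t i) (0 : R[X]) := by simp
    rw [h0, ← apply_ite (fun p : R[X] => aeval (t i) p)]
    refine aeval_eq_of_eval_eq hu (ht i) fun d => ?_
    rcases eq_or_ne c c' with rfl | hc
    · by_cases h : d = c <;> simp [bpoly_eval hu, h]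
    · by_cases h : d = c <;> simp [bpoly_eval hu, h, hc]
  have hs (i : Fin n) : ∑ c, aeval (t i) (bpoly R r u c) = 1 := by
    rw [← map_sum, ← map_one (aeval (R := R) (t i))]
    refine aeval_eq_of_eval_eq hu (ht i) fun d => ?_
    simp [eval_finsetSum, bpoly_eval hu]
  have hm (i : Fin n) (c : Fin r) : u c • aeval (t i) (bpoly R r u c) =
      t i * aeval (t i) (bpoly R r u c) := by
    have h1 : t i = aeval (t i) (X : R[X]) := by simp
    conv_rhs => enter [1]; rw [h1]
    rw [← map_mul, ← map_smul]
    refine aeval_eq_of_eval_eq hu (ht i) fun d => ?_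
    rw [eval_smul, eval_mul, bpoly_eval hu, eval_X]
    split_ifs <;> simp_all
  have hs' : ∑ k : Fin n → Fin r, ∏ i, aeval (t i) (bpoly R r u (k i)) = 1 := by
    have := Finset.prod_univ_sum (fun _ : Fin n => (Finset.univ : Finset (Fin r)))
      (fun i c => aeval (t i) (bpoly R r u c))
    simpa [hs] using this.symm
  refine ⟨idemHom (fun k => ∏ i, aeval (t i) (bpoly R r u (k i))) ?_ hs', ?_⟩
  · intro k k'
    rw [← Finset.prod_mul_distrib]
    simp only [ho]
    split_ifs with h
    · simp [h]
    · obtain ⟨i, hi⟩ := Function.ne_iff.mp h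
      exact Finset.prod_eq_zero (Finset.mem_univ i) (if_neg hi)
  · intro i
    rw [idemHom_apply, ← mul_one (t i), ← hs', Finset.mul_sum]
    refine Finset.sum_congr rfl fun k _ => ?_
    rw [← Finset.mul_prod_erase _ _ (Finset.mem_univ i), ← smul_mul_assoc, coordFun, hm, mul_assoc]

open scoped IsMulCommutative in
lemma exists_algHom_coordFun {A : Type*} [Ring A] [Algebra R A] {u : Fin r → R}
    (hu : Pairwise fun c c' => IsUnit (u c - u c')) (t : Fin n → A)
    (hc : ∀ i i', t i * t i' = t i' * t i)
    (ht : ∀ i, aeval (t i) (∏ c : Fin r, (X - C (u c))) = 0) :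
    ∃ D : ((Fin n → Fin r) → R) →ₐ[R] A, ∀ i, D (coordFun u i) = t i := by
  have := Algebra.isMulCommutative_adjoin R (s := Set.range t) (by
    rintro _ ⟨i, rfl⟩ _ ⟨i', rfl⟩
    exact hc i i')
  obtain ⟨D, hD⟩ := exists_algHom_coordFun_comm (S := Algebra.adjoin R (Set.range t)) hu
    (fun i => ⟨t i, Algebra.subset_adjoin ⟨i, rfl⟩⟩) (fun i => by
      apply Subtype.val_injective
      have := Polynomial.aeval_algHom_apply (Algebra.adjoin R (Set.range t)).val
        ⟨t i, Algebra.subset_adjoin ⟨i, rfl⟩⟩ (∏ c : Fin r, (X - C (u c)))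
      exact this.symm.trans (ht i))
  exact ⟨(Algebra.adjoin R (Set.range t)).val.comp D, fun i => by
    rw [AlgHom.comp_apply, hD]; rfl⟩

section

variable {A : Type*} [Ring A] [Algebra R A] (D : ((Fin n → Fin r) → R) →ₐ[R] A)

lemma aeval_coordFun (u : Fin r → R) (i : Fin n) (p : R[X]) :
    aeval (D (coordFun u i)) p = D fun k => p.eval (u (k i)) := by
  rw [aeval_algHom_apply]
  congr 1
  funext k
  simp [coordFun]

lemma prod_aeval_coordFun {u : Fin r → R} (hu : Pairwise fun c c' => IsUnit (u c - u c'))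
    (k : Fin n → Fin r) :
    (List.ofFn fun i : Fin n => aeval (D (coordFun u i)) (bpoly R r u (k i))).prod =
      D (Pi.single k 1) := by
  simp only [aeval_coordFun, bpoly_eval hu]
  have : (List.ofFn fun i : Fin n => D fun k' : Fin n → Fin r => if k' i = k i then (1 : R) else 0)
      = (List.ofFn fun i : Fin n => fun k' : Fin n → Fin r =>
        if k' i = k i then (1 : R) else 0).map D := by
    rw [List.map_ofFn]; rfl
  rw [this, ← map_list_prod, List.prod_ofFn]
  congr 1
  funext k'
  rw [Finset.prod_apply, Pi.single_apply]
  split_ifs with h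
  · simp [h]
  · obtain ⟨i, hi⟩ := Function.ne_iff.mp h
    exact Finset.prod_eq_zero (Finset.mem_univ i) (if_neg hi)

lemma algHom_ext_coordFun {u : Fin r → R} (hu : Pairwise fun c c' => IsUnit (u c - u c'))
    {D D' : ((Fin n → Fin r) → R) →ₐ[R] A} (h : ∀ i, D (coordFun u i) = D' (coordFun u i)) :
    D = D' := by
  refine AlgHom.ext fun f => ?_
  rw [eq_sum_smul_single f]
  simp only [map_sum, map_smul, ← prod_aeval_coordFun _ hu, h]

/-- An element intertwining the coordinates intertwines all functions. -/
lemma intertwine_of_coordFun {u : Fin r → R} (hu : Pairwise fun c c' => IsUnit (u c - u c'))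
    {x : A} {j : Fin (n - 1)}
    (h : ∀ i, x * D (coordFun u i) = D (swapFun j (coordFun u i)) * x)
    (f : (Fin n → Fin r) → R) : x * D f = D (swapFun j f) * x := by
  let S : Subalgebra R ((Fin n → Fin r) → R) :=
    { carrier := {f | x * D f = D (swapFun j f) * x}
      mul_mem' := fun {f f'} hf hf' => by
        have hs : swapFun j (f * f') = swapFun j f * swapFun j f' := rfl
        simp only [Set.mem_ofPred_eq] at hf hf' ⊢
        rw [hs, map_mul, map_mul, ← mul_assoc, hf, mul_assoc, hf', mul_assoc]
      add_mem' := fun {f f'} hf hf' => by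
        have hs : swapFun j (f + f') = swapFun j f + swapFun j f' := rfl
        simp only [Set.mem_ofPred_eq] at hf hf' ⊢
        rw [hs, map_add, map_add, mul_add, hf, hf', add_mul]
      algebraMap_mem' := fun c => by
        have hs : swapFun j (algebraMap R ((Fin n → Fin r) → R) c) = algebraMap R _ c := rfl
        simp only [Set.mem_ofPred_eq]
        rw [hs, AlgHom.commutes, Algebra.commutes] }
  have hsingle (k : Fin n → Fin r) : (Pi.single k 1 : (Fin n → Fin r) → R) ∈ S := by
    have hk := prod_aeval_coordFun (AlgHom.id R ((Fin n → Fin r) → R)) hu k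
    rw [AlgHom.id_apply] at hk
    rw [← hk]
    refine list_prod_mem fun y hy => ?_
    obtain ⟨i, rfl⟩ := List.mem_ofFn.mp hy
    have hy' := (aeval (⟨coordFun u i, h i⟩ : S) (bpoly R r u (k i))).2
    rwa [← Subalgebra.aeval_coe] at hy'
  have hf := eq_sum_smul_single f
  have : f ∈ S := by
    rw [hf]
    exact sum_mem fun k _ => S.smul_mem (hsingle k) _
  exact this

/-- The quadratic relation transfers from `x` to `x + D (ltFun a _ _)`. -/
lemma quadratic_iff {x : A} {j : Fin (n - 1)} {a : R}
    (h : ∀ f, x * D f = D (swapFun j f) * x) :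
    (x + D (ltFun a (lo n j) (hi n j))) * (x + D (ltFun a (lo n j) (hi n j))) =
        1 + a • (x + D (ltFun a (lo n j) (hi n j))) ↔
      x * x = 1 + D (eqFun a (lo n j) (hi n j)) * x := by
  have h1 : swapFun (r := r) j (ltFun a (lo n j) (hi n j)) = algebraMap R _ a -
      ltFun a (lo n j) (hi n j) - eqFun a (lo n j) (hi n j) := by
    funext k
    simp only [swapFun_ltFun, ltFun, eqFun, Pi.sub_apply, Equiv.swap_apply_left,
      Equiv.swap_apply_right, Pi.algebraMap_apply, Algebra.algebraMap_self_apply]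
    rcases lt_trichotomy (k (lo n j)) (k (hi n j)) with hk | hk | hk
    · simp [hk, hk.ne, hk.not_gt]
    · simp [hk]
    · simp [hk, hk.ne', hk.not_gt]
  have h2 : D (ltFun a (lo n j) (hi n j)) * D (ltFun a (lo n j) (hi n j)) =
      a • D (ltFun a (lo n j) (hi n j)) := by
    rw [← map_mul, ← map_smul]
    congr 1
    funext k
    by_cases hk : k (lo n j) < k (hi n j) <;> simp [ltFun, hk]
  have key : (x + D (ltFun a (lo n j) (hi n j))) * (x + D (ltFun a (lo n j) (hi n j))) -
        (1 + a • (x + D (ltFun a (lo n j) (hi n j)))) =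
      x * x - (1 + D (eqFun a (lo n j) (hi n j)) * x) := by
    rw [mul_add, add_mul, add_mul, h, h1, h2, map_sub, map_sub, AlgHom.commutes, sub_mul, sub_mul,
      ← Algebra.smul_def, smul_add]
    abel
  rw [← sub_eq_zero, key, sub_eq_zero]

lemma braid_add_iff {x y P Q S P' Q' E G : A}
    (hxP : x * P = P' * x) (hxQ : x * Q = S * x) (hxS : x * S = Q * x)
    (hyP : y * P = S * y) (hyQ : y * Q = Q' * y) (hyS : y * S = P * y)
    (hx2 : x * x = 1 + E * x) (hy2 : y * y = 1 + G * y)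
    (h1 : S * E + P * Q + S * P' = Q * S) (h2 : P * S = S * G + Q * P + S * Q')
    (h3 : P * Q * P = Q * P * Q) :
    (x + P) * (y + Q) * (x + P) = (y + Q) * (x + P) * (y + Q) ↔ x * y * x = y * x * y := by
  have e1 : x * Q * x = S + S * E * x := by
    rw [hxQ, mul_assoc, hx2, mul_add, mul_one, mul_assoc]
  have e2 : x * y * P = Q * x * y := by
    rw [mul_assoc, hyP, ← mul_assoc, hxS]
  have e3 : P * y * P = P * S * y := by rw [mul_assoc, hyP, mul_assoc]
  have e4 : x * Q * P = S * P' * x := by rw [hxQ, mul_assoc, hxP, mul_assoc]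
  have e5 : y * P * y = S + S * G * y := by
    rw [hyP, mul_assoc, hy2, mul_add, mul_one, mul_assoc]
  have e6 : y * x * Q = P * y * x := by
    rw [mul_assoc, hxQ, ← mul_assoc, hyS]
  have e7 : Q * x * Q = Q * S * x := by rw [mul_assoc, hxQ, mul_assoc]
  have e8 : y * P * Q = S * Q' * y := by rw [hyP, mul_assoc, hyQ, mul_assoc]
  have key : (x + P) * (y + Q) * (x + P) - (y + Q) * (x + P) * (y + Q) =
      x * y * x - y * x * y := by
    simp only [mul_add, add_mul, e1, e2, e3, e4, e5, e6, e7, e8, ← h1, h2, h3]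
    abel
  rw [← sub_eq_zero, key, sub_eq_zero]

lemma braid_add_ltFun {x y : A} {j k : Fin (n - 1)} (hjk : k.1 = j.1 + 1) {a : R}
    (hx : ∀ f, x * D f = D (swapFun j f) * x) (hy : ∀ f, y * D f = D (swapFun k f) * y)
    (hx2 : x * x = 1 + D (eqFun a (lo n j) (hi n j)) * x)
    (hy2 : y * y = 1 + D (eqFun a (lo n k) (hi n k)) * y) :
    (x + D (ltFun a (lo n j) (hi n j))) * (y + D (ltFun a (lo n k) (hi n k))) *
        (x + D (ltFun a (lo n j) (hi n j))) =
      (y + D (ltFun a (lo n k) (hi n k))) * (x + D (ltFun a (lo n j) (hi n j))) *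
        (y + D (ltFun a (lo n k) (hi n k))) ↔ x * y * x = y * x * y := by
  have hlk : lo n k = hi n j := by simp [lo, hi, hjk]
  rw [hlk] at hy2 ⊢
  have n1 : lo n j ≠ hi n j := lo_ne_hi j
  have n2 : hi n j ≠ hi n k := by simp [hi, hjk]
  have n3 : lo n j ≠ hi n k := by simp [lo, hi, hjk]; omega
  have s1 : Equiv.swap (lo n j) (hi n j) (hi n k) = hi n k :=
    Equiv.swap_apply_of_ne_of_ne n3.symm n2.symm
  have s2 : Equiv.swap (hi n j) (hi n k) (lo n j) = lo n j :=
    Equiv.swap_apply_of_ne_of_ne n1 n3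
  refine braid_add_iff (S := D (ltFun a (lo n j) (hi n k)))
    (P' := D (ltFun a (hi n j) (lo n j))) (Q' := D (ltFun a (hi n k) (hi n j)))
    ?_ ?_ ?_ ?_ ?_ ?_ hx2 hy2 ?_ ?_ ?_
  iterate 3
    rw [hx, swapFun_ltFun]
    simp only [Equiv.swap_apply_left, Equiv.swap_apply_right, s1]
  iterate 3
    rw [hy, swapFun_ltFun]
    simp only [Equiv.swap_apply_left, Equiv.swap_apply_right, hlk, s2]
  all_goals
    simp only [← map_mul, ← map_add]
    congr 1
    funext m
    simp only [ltFun, eqFun, Pi.mul_apply, Pi.add_apply]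
    split_ifs <;> first | ring1 | (exfalso; order)

lemma comm_add_ltFun {x y : A} {j k : Fin (n - 1)} (hjk : j.1 + 2 ≤ k.1 ∨ k.1 + 2 ≤ j.1) {a : R}
    (hx : ∀ f, x * D f = D (swapFun j f) * x) (hy : ∀ f, y * D f = D (swapFun k f) * y) :
    (x + D (ltFun a (lo n j) (hi n j))) * (y + D (ltFun a (lo n k) (hi n k))) =
      (y + D (ltFun a (lo n k) (hi n k))) * (x + D (ltFun a (lo n j) (hi n j))) ↔
      x * y = y * x := by
  have n1 : lo n j ≠ lo n k := by simp [lo]; omega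
  have n2 : lo n j ≠ hi n k := by simp [lo, hi]; omega
  have n3 : hi n j ≠ lo n k := by simp [lo, hi]; omega
  have n4 : hi n j ≠ hi n k := by simp [hi]; omega
  have e1 : x * D (ltFun a (lo n k) (hi n k)) = D (ltFun a (lo n k) (hi n k)) * x := by
    rw [hx, swapFun_ltFun, Equiv.swap_apply_of_ne_of_ne n1.symm n3.symm,
      Equiv.swap_apply_of_ne_of_ne n2.symm n4.symm]
  have e2 : y * D (ltFun a (lo n j) (hi n j)) = D (ltFun a (lo n j) (hi n j)) * y := by
    rw [hy, swapFun_ltFun, Equiv.swap_apply_of_ne_of_ne n1 n2,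
      Equiv.swap_apply_of_ne_of_ne n3 n4]
  have e3 : D (ltFun a (lo n j) (hi n j)) * D (ltFun a (lo n k) (hi n k)) =
      D (ltFun a (lo n k) (hi n k)) * D (ltFun a (lo n j) (hi n j)) :=
    (Commute.all _ _).map D
  have key : (x + D (ltFun a (lo n j) (hi n j))) * (y + D (ltFun a (lo n k) (hi n k))) -
      (y + D (ltFun a (lo n k) (hi n k))) * (x + D (ltFun a (lo n j) (hi n j))) =
      x * y - y * x := by
    simp only [mul_add, add_mul, e1, e2, e3]
    abel
  rw [← sub_eq_zero, key, sub_eq_zero]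

lemma add_ltFun_mul_coordFun_hi_iff {x : A} (u : Fin r → R) (j : Fin (n - 1)) (a : R) :
    (x + D (ltFun a (lo n j) (hi n j))) * D (coordFun u (hi n j)) =
        D (coordFun u (lo n j)) * (x + D (ltFun a (lo n j) (hi n j))) +
          D (ltFun a (lo n j) (hi n j) * (coordFun u (hi n j) - coordFun u (lo n j))) ↔
      x * D (coordFun u (hi n j)) = D (coordFun u (lo n j)) * x := by
  have hc := ((Commute.all (coordFun u (lo n j)) (ltFun a (lo n j) (hi n j))).map D).eq
  have key : (x + D (ltFun a (lo n j) (hi n j))) * D (coordFun u (hi n j)) -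
        (D (coordFun u (lo n j)) * (x + D (ltFun a (lo n j) (hi n j))) +
          D (ltFun a (lo n j) (hi n j) * (coordFun u (hi n j) - coordFun u (lo n j)))) =
      x * D (coordFun u (hi n j)) - D (coordFun u (lo n j)) * x := by
    rw [map_mul, map_sub, mul_add, hc]
    noncomm_ring
  rw [← sub_eq_zero, key, sub_eq_zero]

lemma add_ltFun_mul_coordFun_lo_iff {x : A} (u : Fin r → R) (j : Fin (n - 1)) (a : R) :
    (x + D (ltFun a (lo n j) (hi n j))) * D (coordFun u (lo n j)) =
        D (coordFun u (hi n j)) * (x + D (ltFun a (lo n j) (hi n j))) -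
          D (ltFun a (lo n j) (hi n j) * (coordFun u (hi n j) - coordFun u (lo n j))) ↔
      x * D (coordFun u (lo n j)) = D (coordFun u (hi n j)) * x := by
  have hc := ((Commute.all (coordFun u (hi n j)) (ltFun a (lo n j) (hi n j))).map D).eq
  have key : (x + D (ltFun a (lo n j) (hi n j))) * D (coordFun u (lo n j)) -
        (D (coordFun u (hi n j)) * (x + D (ltFun a (lo n j) (hi n j))) -
          D (ltFun a (lo n j) (hi n j) * (coordFun u (hi n j) - coordFun u (lo n j)))) =
      x * D (coordFun u (lo n j)) - D (coordFun u (hi n j)) * x := by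
    rw [map_mul, map_sub, mul_add, hc]
    noncomm_ring
  rw [← sub_eq_zero, key, sub_eq_zero]

lemma add_ltFun_mul_coordFun_iff {x : A} (u : Fin r → R) (j : Fin (n - 1)) (i : Fin n) (a : R) :
    (x + D (ltFun a (lo n j) (hi n j))) * D (coordFun u i) =
        D (coordFun u i) * (x + D (ltFun a (lo n j) (hi n j))) ↔
      x * D (coordFun u i) = D (coordFun u i) * x := by
  have hc := ((Commute.all (coordFun u i) (ltFun a (lo n j) (hi n j))).map D).eq
  rw [mul_add, add_mul, hc, add_left_inj]

lemma map_Bel {q Δ : Rˣ} {u : Fin r → R} {F : Fin r → R[X]}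
    (hF : ∀ c c' : Fin r, (F c).eval (u c') = if c' = c then (Δ : R) else 0)
    (f : FA R n →ₐ[R] A) (hf : ∀ i, f (tf R n i) = D (coordFun u i)) (j : Fin (n - 1)) :
    f (Bel R n r q Δ u F j) = D (ltFun ((q : R) - ((q⁻¹ : Rˣ) : R)) (lo n j) (hi n j) *
      (coordFun u (hi n j) - coordFun u (lo n j))) := by
  simp only [Bel, map_sum, map_smul, map_mul, ← aeval_algHom_apply, hf, aeval_coordFun]
  simp only [← map_mul, ← map_smul, ← map_sum]
  congr 1
  funext k
  simp only [hF, Finset.sum_apply, Pi.smul_apply, Pi.mul_apply, Pi.sub_apply, coordFun, ltFun,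
    smul_eq_mul]
  rw [Finset.sum_eq_single (k (hi n j)) (fun c _ hc => Finset.sum_eq_zero fun c' _ => by
    simp [hc.symm]) (by simp)]
  have hΔ : ((Δ⁻¹ : Rˣ) : R) * Δ = 1 := Δ.inv_mul
  by_cases h : k (lo n j) < k (hi n j)
  · rw [if_pos h, Finset.sum_eq_single (k (lo n j)) (fun c _ hc => by simp [hc.symm])
      (fun hc => absurd h (by simpa using hc))]
    simp only [if_true]
    linear_combination ((u (k (hi n j)) - u (k (lo n j))) * ((q : R) - ((q⁻¹ : Rˣ) : R))) *
      (((Δ⁻¹ : Rˣ) : R) * Δ + 1) * hΔ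
  · rw [if_neg h, zero_mul]
    refine Finset.sum_eq_zero fun c hc => ?_
    have : k (lo n j) ≠ c := by
      rintro rfl
      exact h (by simpa using hc)
    simp [this]

/-- The relations of the parameter-free presentation, for the idempotents encoded by `D` and the
braid generators `x`. -/
structure IsFramed (a : R) (x : Fin (n - 1) → A) : Prop where
  intertwine : ∀ j f, x j * D f = D (swapFun j f) * x j
  quad : ∀ j, x j * x j = 1 + D (eqFun a (lo n j) (hi n j)) * x j
  braid : ∀ j k : Fin (n - 1), k.1 = j.1 + 1 → x j * x k * x j = x k * x j * x k
  comm : ∀ j k : Fin (n - 1), (j.1 + 2 ≤ k.1 ∨ k.1 + 2 ≤ j.1) → x j * x k = x k * x j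

lemma quad_iff (q : Rˣ) (T : A) :
    (T - algebraMap R A (q : R)) * (T + algebraMap R A ((q⁻¹ : Rˣ) : R)) = 0 ↔
      T * T = 1 + ((q : R) - ((q⁻¹ : Rˣ) : R)) • T := by
  have h : (T - algebraMap R A (q : R)) * (T + algebraMap R A ((q⁻¹ : Rˣ) : R)) =
      T * T - (1 + ((q : R) - ((q⁻¹ : Rˣ) : R)) • T) := by
    rw [sub_mul, mul_add, mul_add, ← map_mul, Units.mul_inv, map_one, ← Algebra.commutes,
      ← Algebra.smul_def, ← Algebra.smul_def, sub_smul]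
    abel
  rw [h, sub_eq_zero]

variable {D}

lemma IsFramed.exists_lift_Hnr2 {q : Rˣ} {x : Fin (n - 1) → A}
    (h : IsFramed D ((q : R) - ((q⁻¹ : Rˣ) : R)) x) :
    ∃ φ : Hnr2 R n r q →ₐ[R] A, (∀ j, φ (gg2 R n r q j) = x j) ∧
      ∀ k, φ (bb2 R n r q k) = D (Pi.single k 1) := by
  let f : FA2 R n r →ₐ[R] A :=
    FreeAlgebra.lift R (Sum.elim x fun k => D (Pi.single k 1))
  have hg (j) : f (gf2 R n r j) = x j := FreeAlgebra.lift_ι_apply _ _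
  have hb (k) : f (bf2 R n r k) = D (Pi.single k 1) := FreeAlgebra.lift_ι_apply _ _
  have hrel : ∀ ⦃y z⦄, Rel2 R n r q y z → f y = f z := by
    intro y z hyz
    induction hyz with
    | gcomm j k hjk => simpa only [map_mul, hg] using h.comm j k hjk
    | gbraid j k hjk => simpa only [map_mul, hg] using h.braid j k hjk
    | gquad j =>
      simp only [map_mul, map_add, map_one, map_smul, hg, ef2, map_sum, hb]
      rw [h.quad, ← smul_mul_assoc, ← map_sum, ← map_smul]
      congr 3
      funext k
      simp [Finset.sum_apply, Pi.single_apply, eqFun, Finset.sum_ite_eq]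
    | borth k k' =>
      rw [map_mul, apply_ite f, hb, hb, map_zero, ← map_mul]
      split_ifs with hk
      · subst hk
        rw [← Pi.single_mul, one_mul]
      · have h0 : (Pi.single k 1 * Pi.single k' 1 : (Fin n → Fin r) → R) = 0 := by
          funext m
          by_cases hm : m = k <;> simp_all [Pi.single_apply]
        rw [h0, map_zero]
    | gb j k =>
      rw [map_mul, map_mul, hg, hb, hb, h.intertwine]
      congr 2
      funext k'
      simp only [swapFun, Pi.single_apply]
      congr 1
      rw [eq_iff_iff]
      constructor
      · rintro rfl; funext i; simp
      · rintro rfl; funext i; simp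
    | bsum =>
      rw [map_sum, map_one, ← map_one D]
      simp only [hb]
      rw [← map_sum]
      congr 1
      funext k
      simp [Finset.sum_apply, Pi.single_apply]
  refine ⟨RingQuot.liftAlgHom R ⟨f, hrel⟩, fun j => ?_, fun k => ?_⟩
  · rw [gg2, RingQuot.liftAlgHom_mkAlgHom_apply, hg]
  · rw [bb2, RingQuot.liftAlgHom_mkAlgHom_apply, hb]

lemma IsFramed.exists_lift_Hnr {q Δ : Rˣ} {u : Fin r → R} {F : Fin r → R[X]}
    (hF : ∀ c c' : Fin r, (F c).eval (u c') = if c' = c then (Δ : R) else 0)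
    {x : Fin (n - 1) → A} (h : IsFramed D ((q : R) - ((q⁻¹ : Rˣ) : R)) x) :
    ∃ ψ : Hnr R n r q Δ u F →ₐ[R] A, (∀ i, ψ (tt R n r q Δ u F i) = D (coordFun u i)) ∧
      ∀ j, ψ (TT R n r q Δ u F j) =
        x j + D (ltFun ((q : R) - ((q⁻¹ : Rˣ) : R)) (lo n j) (hi n j)) := by
  let f : FA R n →ₐ[R] A := FreeAlgebra.lift R (Sum.elim (fun i => D (coordFun u i)) fun j =>
    x j + D (ltFun ((q : R) - ((q⁻¹ : Rˣ) : R)) (lo n j) (hi n j)))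
  have ht (i) : f (tf R n i) = D (coordFun u i) := FreeAlgebra.lift_ι_apply _ _
  have hT (j) : f (Tf R n j) = x j + D (ltFun ((q : R) - ((q⁻¹ : Rˣ) : R)) (lo n j) (hi n j)) :=
    FreeAlgebra.lift_ι_apply _ _
  have hrel : ∀ ⦃y z⦄, Rel R n r q Δ u F y z → f y = f z := by
    intro y z hyz
    induction hyz with
    | quad j =>
      simp only [map_mul, map_sub, map_add, AlgHom.commutes, map_zero]
      rw [quad_iff, hT]
      exact (quadratic_iff D (h.intertwine j)).2 (h.quad j)
    | tord i =>
      rw [← aeval_algHom_apply, ht, aeval_coordFun, map_zero, ← map_zero D]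
      congr 1
      funext k
      rw [eval_prod]
      exact Finset.prod_eq_zero (Finset.mem_univ (k i)) (by simp)
    | braid j k hjk =>
      simp only [map_mul, hT]
      exact (braid_add_ltFun D hjk (h.intertwine j) (h.intertwine k) (h.quad j) (h.quad k)).2
        (h.braid j k hjk)
    | Tcomm j k hjk =>
      simp only [map_mul, hT]
      exact (comm_add_ltFun D hjk (h.intertwine j) (h.intertwine k)).2 (h.comm j k hjk)
    | tcomm i i' =>
      simp only [map_mul, ht]
      exact ((Commute.all _ _).map D).eq
    | Tt j i h1 h2 =>
      simp only [map_mul, hT, ht]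
      rw [add_ltFun_mul_coordFun_iff, h.intertwine, swapFun_coordFun,
        Equiv.swap_apply_of_ne_of_ne h1 h2]
    | Thi j =>
      simp only [map_mul, map_add, hT, ht]
      rw [map_Bel D hF f ht, add_ltFun_mul_coordFun_hi_iff, h.intertwine, swapFun_coordFun,
        Equiv.swap_apply_right]
    | Tlo j =>
      simp only [map_mul, map_sub, hT, ht]
      rw [map_Bel D hF f ht, add_ltFun_mul_coordFun_lo_iff, h.intertwine, swapFun_coordFun,
        Equiv.swap_apply_left]
  refine ⟨RingQuot.liftAlgHom R ⟨f, hrel⟩, fun i => ?_, fun j => ?_⟩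
  · rw [tt, pim, RingQuot.liftAlgHom_mkAlgHom_apply, ht]
  · rw [TT, pim, RingQuot.liftAlgHom_mkAlgHom_apply, hT]

end

lemma exists_isFramed_Hnr2 (R : Type*) [CommRing R] (n r : ℕ) (q : Rˣ) :
    ∃ D : ((Fin n → Fin r) → R) →ₐ[R] Hnr2 R n r q,
      (∀ k, D (Pi.single k 1) = bb2 R n r q k) ∧
      IsFramed D ((q : R) - ((q⁻¹ : Rˣ) : R)) (gg2 R n r q) := by
  have ho (k k') : bb2 R n r q k * bb2 R n r q k' = if k = k' then bb2 R n r q k else 0 := by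
    have := RingQuot.mkAlgHom_rel R (Rel2.borth (q := q) k k')
    rw [map_mul, apply_ite (RingQuot.mkAlgHom R _), map_zero] at this
    exact this
  have hs : ∑ k, bb2 R n r q k = 1 := by
    have := RingQuot.mkAlgHom_rel R (Rel2.bsum (R := R) (n := n) (r := r) (q := q))
    rwa [map_sum, map_one] at this
  refine ⟨idemHom (bb2 R n r q) ho hs, fun k => ?_, fun j f => ?_, fun j => ?_,
    fun j k hjk => ?_, fun j k hjk => ?_⟩
  · simp [idemHom_apply, Pi.single_apply]
  · have hgb (k) : gg2 R n r q j * bb2 R n r q k =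
        bb2 R n r q (fun i => k (Equiv.swap (lo n j) (hi n j) i)) * gg2 R n r q j := by
      have := RingQuot.mkAlgHom_rel R (Rel2.gb (q := q) j k)
      rwa [map_mul, map_mul] at this
    rw [idemHom_apply, idemHom_apply, Finset.mul_sum, Finset.sum_mul]
    let s : (Fin n → Fin r) ≃ (Fin n → Fin r) :=
      Equiv.arrowCongr (Equiv.swap (lo n j) (hi n j)) (Equiv.refl _)
    refine Fintype.sum_equiv s _ _ fun k => ?_
    have hk : s k = fun i => k (Equiv.swap (lo n j) (hi n j) i) := rfl
    rw [mul_smul_comm, hgb, smul_mul_assoc, hk]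
    simp [swapFun]
  · have := RingQuot.mkAlgHom_rel R (Rel2.gquad (r := r) (q := q) j)
    rw [map_mul, map_add, map_one, map_smul, map_mul, ef2, map_sum, ← smul_mul_assoc] at this
    refine this.trans ?_
    rw [idemHom_apply, Finset.smul_sum, Finset.sum_filter]
    simp only [eqFun, ite_smul, zero_smul]
    rfl
  · have := RingQuot.mkAlgHom_rel R (Rel2.gbraid (r := r) (q := q) j k hjk)
    simpa only [gg2, map_mul] using this
  · have := RingQuot.mkAlgHom_rel R (Rel2.gcomm (r := r) (q := q) j k hjk)
    simpa only [gg2, map_mul] using this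

lemma exists_isFramed_Hnr {q Δ : Rˣ} {u : Fin r → R} {F : Fin r → R[X]}
    (hu : Pairwise fun c c' => IsUnit (u c - u c'))
    (hF : ∀ c c' : Fin r, (F c).eval (u c') = if c' = c then (Δ : R) else 0) :
    ∃ D : ((Fin n → Fin r) → R) →ₐ[R] Hnr R n r q Δ u F,
      (∀ i, D (coordFun u i) = tt R n r q Δ u F i) ∧
      (∀ k, D (Pi.single k 1) = b R n r q Δ u F k) ∧
      (∀ j, g R n r q Δ u F j = TT R n r q Δ u F j -
        D (ltFun ((q : R) - ((q⁻¹ : Rˣ) : R)) (lo n j) (hi n j))) ∧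
      IsFramed D ((q : R) - ((q⁻¹ : Rˣ) : R)) (g R n r q Δ u F) := by
  have rel {y z} (h : Rel R n r q Δ u F y z) : pim R n r q Δ u F y = pim R n r q Δ u F z :=
    RingQuot.mkAlgHom_rel R h
  obtain ⟨D, hD⟩ := exists_algHom_coordFun hu (tt R n r q Δ u F)
    (fun i i' => by simpa only [tt, TT, map_mul] using rel (Rel.tcomm i i'))
    (fun i => by simpa only [tt, ← aeval_algHom_apply, map_zero] using rel (Rel.tord i))
  have hb (k) : D (Pi.single k 1) = b R n r q Δ u F k := by
    rw [← prod_aeval_coordFun D hu]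
    simp only [hD, b]
  have hg (j) : g R n r q Δ u F j = TT R n r q Δ u F j -
      D (ltFun ((q : R) - ((q⁻¹ : Rˣ) : R)) (lo n j) (hi n j)) := by
    rw [g, B', ← sub_eq_add_neg]
    simp only [← hb]
    rw [← map_sum, ← map_smul]
    congr 2
    funext k
    simp [Finset.sum_apply, Pi.single_apply, ltFun]
  have hT (j) : TT R n r q Δ u F j = g R n r q Δ u F j +
      D (ltFun ((q : R) - ((q⁻¹ : Rˣ) : R)) (lo n j) (hi n j)) := by rw [hg, sub_add_cancel]
  have hBel := map_Bel D (q := q) hF (pim R n r q Δ u F) fun i => (hD i).symm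
  have hint (j) : ∀ f, g R n r q Δ u F j * D f = D (swapFun j f) * g R n r q Δ u F j := by
    refine intertwine_of_coordFun D hu fun i => ?_
    rw [swapFun_coordFun]
    by_cases h1 : i = lo n j
    · subst h1
      rw [Equiv.swap_apply_left, ← add_ltFun_mul_coordFun_lo_iff, ← hT, ← hBel, hD, hD]
      simpa only [tt, TT, map_mul, map_sub] using rel (Rel.Tlo j)
    by_cases h2 : i = hi n j
    · subst h2
      rw [Equiv.swap_apply_right, ← add_ltFun_mul_coordFun_hi_iff, ← hT, ← hBel, hD, hD]
      simpa only [tt, TT, map_mul, map_add] using rel (Rel.Thi j)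
    rw [Equiv.swap_apply_of_ne_of_ne h1 h2, ← add_ltFun_mul_coordFun_iff, ← hT, hD]
    simpa only [tt, TT, map_mul] using rel (Rel.Tt j i h1 h2)
  have hquad (j) : g R n r q Δ u F j * g R n r q Δ u F j =
      1 + D (eqFun ((q : R) - ((q⁻¹ : Rˣ) : R)) (lo n j) (hi n j)) * g R n r q Δ u F j := by
    rw [← quadratic_iff D (hint j), ← hT, ← quad_iff]
    simpa only [tt, TT, map_mul, map_sub, map_add, AlgHom.commutes, map_zero] using rel (Rel.quad j)
  refine ⟨D, hD, hb, hg, hint, hquad, fun j k hjk => ?_, fun j k hjk => ?_⟩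
  · rw [← braid_add_ltFun D hjk (hint j) (hint k) (hquad j) (hquad k), ← hT, ← hT]
    simpa only [tt, TT, map_mul] using rel (Rel.braid j k hjk)
  · rw [← comm_add_ltFun D hjk (hint j) (hint k), ← hT, ← hT]
    simpa only [tt, TT, map_mul] using rel (Rel.Tcomm j k hjk)

lemma isUnit_sub_of_prod {u : Fin r → R}
    (h : IsUnit (∏ i : Fin r, ∏ j ∈ Finset.univ.filter (fun j => j < i), (u i - u j))) :
    Pairwise fun c c' => IsUnit (u c - u c') := by
  have key (c c' : Fin r) (hc : c' < c) : IsUnit (u c - u c') :=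
    isUnit_of_dvd_unit ((Finset.dvd_prod_of_mem (fun j => u c - u j)
      (by simpa using hc : c' ∈ Finset.univ.filter (fun j => j < c))).trans
      (Finset.dvd_prod_of_mem (fun i => ∏ j ∈ Finset.univ.filter (fun j => j < i), (u i - u j))
        (Finset.mem_univ c))) h
  intro c c' hc
  rcases lt_or_gt_of_ne hc with h | h
  · simpa using (key c' c h).neg
  · exact key c c' h

end

end MAK


/-- Theorem 3.13: the presentation of `H_{n,r}` independent of the parameters
`u_1,…,u_r`. -/
theorem statement11
    (R : Type*) [CommRing R] [IsDomain R] (n r : ℕ) (hn : 1 ≤ n) (hr : 1 ≤ r)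
    (q Δ : Rˣ) (u : Fin r → R) (F : Fin r → R[X])
    (hΔ : (Δ : R) = ∏ i : Fin r, ∏ j ∈ Finset.univ.filter (fun j => j < i), (u i - u j))
    (hFdeg : ∀ c : Fin r, (F c).degree = ((r - 1 : ℕ) : WithBot ℕ))
    (hFeval : ∀ c c' : Fin r, (F c).eval (u c') = if c' = c then (Δ : R) else 0) :
    ∃ φ : Hnr2 R n r q →ₐ[R] Hnr R n r q Δ u F,
      (∀ j : Fin (n - 1), φ (gg2 R n r q j) = g R n r q Δ u F j) ∧
      (∀ k : Fin n → Fin r, φ (bb2 R n r q k) = b R n r q Δ u F k) ∧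
      Function.Bijective φ := by
  have hu := isUnit_sub_of_prod (hΔ ▸ Δ.isUnit)
  obtain ⟨D, hDt, hDb, hDg, hD⟩ := exists_isFramed_Hnr (n := n) (q := q) hu hFeval
  obtain ⟨D', hDb', hD'⟩ := exists_isFramed_Hnr2 R n r q
  obtain ⟨φ, hφg, hφb⟩ := hD.exists_lift_Hnr2
  obtain ⟨ψ, hψt, hψT⟩ := hD'.exists_lift_Hnr hFeval
  have hφD (f) : φ (D' f) = D f := by
    rw [eq_sum_smul_single f]
    simp only [map_sum, map_smul, hDb', hφb]
  have hψD (f) : ψ (D f) = D' f := by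
    suffices ψ.comp D = D' from DFunLike.congr_fun this f
    refine algHom_ext_coordFun hu fun i => ?_
    rw [AlgHom.comp_apply, hDt, hψt]
  refine ⟨φ, hφg, fun k => (hφb k).trans (hDb k), ?_⟩
  have h1 : ψ.comp φ = AlgHom.id R _ := by
    refine RingQuot.ringQuot_ext' _ _ _ (FreeAlgebra.hom_ext (funext ?_))
    rintro (j | k)
    · change ψ (φ (gg2 R n r q j)) = gg2 R n r q j
      rw [hφg, hDg, map_sub, hψT, hψD, add_sub_cancel_right]
    · change ψ (φ (bb2 R n r q k)) = bb2 R n r q k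
      rw [hφb, hψD, hDb']
  have h2 : φ.comp ψ = AlgHom.id R _ := by
    refine RingQuot.ringQuot_ext' _ _ _ (FreeAlgebra.hom_ext (funext ?_))
    rintro (i | j)
    · change φ (ψ (tt R n r q Δ u F i)) = tt R n r q Δ u F i
      rw [hψt, hφD, hDt]
    · change φ (ψ (TT R n r q Δ u F j)) = TT R n r q Δ u F j
      rw [hψT, map_add, hφD, hφg, hDg, sub_add_cancel]
  exact Function.bijective_iff_has_inverse.2
    ⟨ψ, fun y => DFunLike.congr_fun h1 y, fun y => DFunLike.congr_fun h2 y⟩
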